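/- For every positive integer r there exists a constant C such that the following holds. For every L and every subspace G ≤ V(Q) on the qubit set Q = Fin L × Fin L that is spanned by generators each supported in some square box of size r×r, with k ≥ 1 logical qubits and distance d: k·d ≤ C·L² (i.e. kd = O(n) with n = L² the number of physical qubits). -/

import Mathlib

set_option linter.unusedSectionVars false

open Finset Matrix

abbrev F2 : Type := ZMod 2

abbrev PauliSpace (Q : Type) := Q → F2 × F2

section Pauli

variable {Q : Type} [Fintype Q] [DecidableEq Q]

/-- Support of a Pauli vector. -/
def psupp (v : PauliSpace Q) : Finset Q := Finset.univ.filter (fun q => v q ≠ (0, 0))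

/-- Weight of a Pauli vector. -/
def pwt (v : PauliSpace Q) : ℕ := (psupp v).card

/-- The symplectic form. -/
def omegaF (u v : PauliSpace Q) : F2 :=
  ∑ q, ((u q).1 * (v q).2 + (u q).2 * (v q).1)

lemma omegaF_add_left (u v w : PauliSpace Q) :
    omegaF (u + v) w = omegaF u w + omegaF v w := by
  simp only [omegaF, Pi.add_apply, Prod.fst_add, Prod.snd_add, ← Finset.sum_add_distrib]
  exact Finset.sum_congr rfl (fun q _ => by ring)

lemma omegaF_smul_left (c : F2) (u w : PauliSpace Q) :
    omegaF (c • u) w = c * omegaF u w := by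
  simp only [omegaF, Pi.smul_apply, Prod.smul_fst, Prod.smul_snd, smul_eq_mul,
    Finset.mul_sum]
  exact Finset.sum_congr rfl (fun q _ => by ring)

/-- Centralizer of a subspace w.r.t. the symplectic form. -/
def pcent (G : Submodule F2 (PauliSpace Q)) : Submodule F2 (PauliSpace Q) where
  carrier := {v | ∀ g ∈ G, omegaF v g = 0}
  zero_mem' := by
    intro g _
    simp [omegaF]
  add_mem' := by
    intro a b ha hb g hg
    rw [omegaF_add_left, ha g hg, hb g hg, add_zero]
  smul_mem' := by
    intro c a ha g hg
    rw [omegaF_smul_left, ha g hg, mul_zero]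

/-- Stabilizer group of a gauge group. -/
def pstab (G : Submodule F2 (PauliSpace Q)) : Submodule F2 (PauliSpace Q) := G ⊓ pcent G

/-- Single-qubit Pauli X vector. -/
def Xop (c : Q) : PauliSpace Q := fun q => if q = c then (1, 0) else (0, 0)

/-- Single-qubit Pauli Z vector. -/
def Zop (c : Q) : PauliSpace Q := fun q => if q = c then (0, 1) else (0, 0)

/-- The set of weights of dressed logical operators; its infimum is the distance. -/
def distSet (G : Submodule F2 (PauliSpace Q)) : Set ℕ :=
  {w | ∃ v, v ∈ pcent (pstab G) ∧ v ∉ G ∧ pwt v = w}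

/-- Pauli vectors supported in `M`. -/
def PMod (M : Finset Q) : Submodule F2 (PauliSpace Q) where
  carrier := {v | ∀ q, q ∉ M → v q = 0}
  zero_mem' := by intro q _; rfl
  add_mem' := by
    intro a b ha hb q hq
    simp [Pi.add_apply, ha q hq, hb q hq]
  smul_mem' := by
    intro c a ha q hq
    simp [Pi.smul_apply, ha q hq]

/-- Projection onto the qubits in `M`. -/
def projL (M : Finset Q) : PauliSpace Q →ₗ[F2] PauliSpace Q where
  toFun v := fun q => if q ∈ M then v q else 0
  map_add' a b := by funext q; by_cases h : q ∈ M <;> simp [h]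
  map_smul' c a := by funext q; by_cases h : q ∈ M <;> simp [h]

/-- Number of independent dressed logical operators supported in `M`. -/
noncomputable def lM (G : Submodule F2 (PauliSpace Q)) (M : Finset Q) : ℕ :=
  Module.finrank F2 ↥(pcent ((pstab G).map (projL M)) ⊓ PMod M)
    - Module.finrank F2 ↥(G ⊓ PMod M)

/-- Number of independent bare logical operators supported in `M`. -/
noncomputable def lbareM (G : Submodule F2 (PauliSpace Q)) (M : Finset Q) : ℕ :=
  Module.finrank F2 ↥(pcent (G.map (projL M)) ⊓ PMod M)
    - Module.finrank F2 ↥(pstab G ⊓ PMod M)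

end Pauli

section Classical

variable {ι : Type} [Fintype ι] [DecidableEq ι]

/-- Hamming weight of a classical vector. -/
def hwt (v : ι → F2) : ℕ := (Finset.univ.filter (fun i => v i ≠ 0)).card

/-- Row space of a matrix. -/
def Crow (A : Matrix ι ι F2) : Submodule F2 (ι → F2) := Submodule.span F2 (Set.range A)

/-- Column space of a matrix. -/
def Ccol (A : Matrix ι ι F2) : Submodule F2 (ι → F2) := Submodule.span F2 (Set.range Aᵀ)

/-- Minimum distance of the row space. -/
noncomputable def drow (A : Matrix ι ι F2) : ℕ := sInf {w | ∃ v ∈ Crow A, v ≠ 0 ∧ hwt v = w}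

/-- Minimum distance of the column space. -/
noncomputable def dcol (A : Matrix ι ι F2) : ℕ := sInf {w | ∃ v ∈ Ccol A, v ≠ 0 ∧ hwt v = w}

/-- Number of nonzero entries of a matrix. -/
def nnz (A : Matrix ι ι F2) : ℕ :=
  (Finset.univ.filter (fun p : ι × ι => A p.1 p.2 ≠ 0)).card

end Classical

section BaconShor

variable {m : ℕ}

/-- Qubit set of the generalized Bacon-Shor code: cells with `A i j = 1`. -/
abbrev QA (A : Matrix (Fin m) (Fin m) F2) : Type := {c : Fin m × Fin m // A c.1 c.2 = 1}

/-- Generators of the gauge group. -/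
def gaugeSet (A : Matrix (Fin m) (Fin m) F2) : Set (PauliSpace (QA A)) :=
  {v | ∃ c c' : QA A, c ≠ c' ∧
    ((c.1.1 = c'.1.1 ∧ v = Xop c + Xop c') ∨ (c.1.2 = c'.1.2 ∧ v = Zop c + Zop c'))}

/-- Gauge group of the generalized Bacon-Shor code. -/
def gaugeBS (A : Matrix (Fin m) (Fin m) F2) : Submodule F2 (PauliSpace (QA A)) :=
  Submodule.span F2 (gaugeSet A)

/-- The row operator `R i`. -/
def Rop (A : Matrix (Fin m) (Fin m) F2) (i : Fin m) : PauliSpace (QA A) :=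
  ∑ c ∈ Finset.univ.filter (fun c : QA A => c.1.1 = i), Zop c

/-- The column operator `C j`. -/
def Cop (A : Matrix (Fin m) (Fin m) F2) (j : Fin m) : PauliSpace (QA A) :=
  ∑ c ∈ Finset.univ.filter (fun c : QA A => c.1.2 = j), Xop c

/-- X-type operator parameterized by a binary vector. -/
def PXop (A : Matrix (Fin m) (Fin m) F2) (x : Fin m → F2) : PauliSpace (QA A) :=
  ∑ j, x j • Cop A j

/-- Z-type operator parameterized by a binary vector. -/
def PZop (A : Matrix (Fin m) (Fin m) F2) (z : Fin m → F2) : PauliSpace (QA A) :=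
  ∑ i, z i • Rop A i

end BaconShor

/-- Binary entropy. -/
noncomputable def H2 (p : ℝ) : ℝ := -p * Real.logb 2 p - (1 - p) * Real.logb 2 (1 - p)
/-- A finite set of lattice sites is contained in some square box of size `r × r`. -/
def InBox {L : ℕ} (r : ℕ) (S : Finset (Fin L × Fin L)) : Prop :=
  ∃ a b : ℕ, ∀ p ∈ S, a ≤ (p.1 : ℕ) ∧ (p.1 : ℕ) < a + r ∧ b ≤ (p.2 : ℕ) ∧ (p.2 : ℕ) < b + r

/-- A subspace has spatially local generators with interaction range `r`: it is spanned
by vectors each supported in some square box of size `r × r`. -/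
def HasLocalGens {L : ℕ} (r : ℕ) (G : Submodule F2 (PauliSpace (Fin L × Fin L))) : Prop :=
  ∃ gens : Set (PauliSpace (Fin L × Fin L)),
    G = Submodule.span F2 gens ∧ ∀ g ∈ gens, InBox r (psupp g)

/-- Cardinality of the boundary `∂M`: the set of sites outside `M` within Chebyshev
distance `r` of some site of `M`. -/
noncomputable def bdryCard {L : ℕ} (r : ℕ) (M : Finset (Fin L × Fin L)) : ℕ :=
  Nat.card {q : Fin L × Fin L // q ∉ M ∧ ∃ p ∈ M,
    Nat.dist (q.1 : ℕ) (p.1 : ℕ) ≤ r ∧ Nat.dist (q.2 : ℕ) (p.2 : ℕ) ≤ r}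

section PauliDuality

variable {Q : Type} [Fintype Q] [DecidableEq Q]

lemma omegaF_comm (u v : PauliSpace Q) : omegaF u v = omegaF v u :=
  Finset.sum_congr rfl fun _ _ => by ring

lemma omegaF_add_right (u v w : PauliSpace Q) :
    omegaF u (v + w) = omegaF u v + omegaF u w := by
  rw [omegaF_comm, omegaF_add_left, omegaF_comm v, omegaF_comm w]

/-- The symplectic form as a bilinear form. -/
def omegaBilin : LinearMap.BilinForm F2 (PauliSpace Q) :=
  LinearMap.mk₂ F2 omegaF omegaF_add_left omegaF_smul_left omegaF_add_right
    (fun c u v => by rw [omegaF_comm, omegaF_smul_left, omegaF_comm, smul_eq_mul])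

lemma omegaBilin_apply (u v : PauliSpace Q) : omegaBilin u v = omegaF u v := rfl

lemma omegaF_Xop (v : PauliSpace Q) (q : Q) : omegaF v (Xop q) = (v q).2 := by
  rw [omegaF, Finset.sum_eq_single q] <;> simp +contextual [Xop]

lemma omegaF_Zop (v : PauliSpace Q) (q : Q) : omegaF v (Zop q) = (v q).1 := by
  rw [omegaF, Finset.sum_eq_single q] <;> simp +contextual [Zop]

lemma omegaBilin_isRefl : (omegaBilin (Q := Q)).IsRefl := fun u v h => by
  rwa [omegaBilin_apply, omegaF_comm]

lemma omegaBilin_nondegenerate : (omegaBilin (Q := Q)).Nondegenerate := by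
  have hleft : ∀ v : PauliSpace Q, (∀ w, omegaF v w = 0) → v = 0 := fun v h =>
    funext fun q => Prod.ext (by simpa [omegaF_Zop] using h (Zop q))
      (by simpa [omegaF_Xop] using h (Xop q))
  exact ⟨hleft, fun v h => hleft v fun w => (omegaF_comm v w).trans (h w)⟩

lemma pcent_eq_orthogonal (G : Submodule F2 (PauliSpace Q)) :
    pcent G = omegaBilin.orthogonal G := by
  ext v
  exact forall₂_congr fun g _ => by rw [omegaF_comm]; rfl

lemma pcent_pcent (G : Submodule F2 (PauliSpace Q)) : pcent (pcent G) = G := by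
  rw [pcent_eq_orthogonal, pcent_eq_orthogonal,
    LinearMap.BilinForm.orthogonal_orthogonal omegaBilin_nondegenerate omegaBilin_isRefl]

lemma pcent_anti {G H : Submodule F2 (PauliSpace Q)} (h : G ≤ H) : pcent H ≤ pcent G :=
  fun _ hv g hg => hv g (h hg)

lemma mem_pcent_span {s : Set (PauliSpace Q)} {v : PauliSpace Q} :
    v ∈ pcent (Submodule.span F2 s) ↔ ∀ g ∈ s, omegaF v g = 0 := by
  refine ⟨fun h g hg => h g (Submodule.subset_span hg), fun h g hg => ?_⟩
  have hle : Submodule.span F2 s ≤ LinearMap.ker (omegaBilin v) := Submodule.span_le.2 h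
  exact hle hg

lemma pcent_PMod_compl_le (M : Finset Q) : pcent (PMod Mᶜ) ≤ PMod M := by
  intro v hv q hq
  have hX : Xop q ∈ PMod Mᶜ := fun p hp => if_neg (by rintro rfl; simp [hq] at hp)
  have hZ : Zop q ∈ PMod Mᶜ := fun p hp => if_neg (by rintro rfl; simp [hq] at hp)
  exact Prod.ext (by simpa [omegaF_Zop] using hv _ hZ) (by simpa [omegaF_Xop] using hv _ hX)

lemma projL_apply (M : Finset Q) (v : PauliSpace Q) (q : Q) :
    projL M v q = if q ∈ M then v q else 0 := rfl

lemma projL_mem_PMod (M : Finset Q) (v : PauliSpace Q) : projL M v ∈ PMod M :=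
  fun _ hq => if_neg hq

lemma pwt_le_card_of_mem_PMod {M : Finset Q} {v : PauliSpace Q} (hv : v ∈ PMod M) :
    pwt v ≤ #M :=
  Finset.card_le_card fun q hq => by
    by_contra h
    exact (Finset.mem_filter.1 hq).2 (hv q h)

lemma omegaF_eq_zero_of_forall {u v : PauliSpace Q} (h : ∀ q, u q = 0 ∨ v q = 0) :
    omegaF u v = 0 :=
  Finset.sum_eq_zero fun q _ => by rcases h q with h | h <;> simp [h]

/-- **Cleaning lemma**: if every dressed logical operator supported in `M` is trivial, every bare
logical operator can be moved off `M` by multiplication with a stabilizer. -/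
lemma exists_add_mem_PMod_compl {G : Submodule F2 (PauliSpace Q)} {M : Finset Q}
    (hM : pcent (pstab G) ⊓ PMod M ≤ G) {v : PauliSpace Q} (hv : v ∈ pcent G) :
    ∃ s ∈ pstab G, v + s ∈ PMod Mᶜ := by
  have hle : pcent G ≤ pstab G ⊔ PMod Mᶜ := by
    rw [← pcent_pcent (pstab G ⊔ PMod Mᶜ)]
    refine pcent_anti (le_trans (le_inf (pcent_anti le_sup_left) ?_) hM)
    exact (pcent_anti le_sup_right).trans (pcent_PMod_compl_le M)
  obtain ⟨s, hs, t, ht, rfl⟩ := Submodule.mem_sup.1 (hle hv)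
  refine ⟨-s, neg_mem hs, ?_⟩
  simpa using ht

lemma le_gauge_of_card_lt {G : Submodule F2 (PauliSpace Q)} {M : Finset Q}
    (h : #M < sInf (distSet G)) : pcent (pstab G) ⊓ PMod M ≤ G := by
  rintro v ⟨hv, hvM⟩
  by_contra hG
  exact Nat.notMem_of_lt_sInf ((pwt_le_card_of_mem_PMod hvM).trans_lt h) ⟨v, hv, hG, rfl⟩

/-- If the bare logical operators supported in `M` are trivial, then the number of logical
operators is bounded by the dimension of the Pauli operators on the complement. -/
lemma finrank_pcent_le {G : Submodule F2 (PauliSpace Q)} {M : Finset Q}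
    (hM : pcent G ⊓ PMod M ≤ G) :
    Module.finrank F2 (pcent G) ≤ Module.finrank F2 (pstab G) + 2 * #Mᶜ := by
  let f : pcent G →ₗ[F2] ((Mᶜ : Finset Q) → F2 × F2) :=
    (LinearMap.funLeft F2 (F2 × F2) Subtype.val).comp (pcent G).subtype
  have hker : (LinearMap.ker f).map (pcent G).subtype ≤ pstab G := by
    rintro _ ⟨⟨v, hv⟩, hf, rfl⟩
    refine ⟨hM ⟨hv, fun q hq => ?_⟩, hv⟩
    exact congrFun (LinearMap.mem_ker.1 hf) ⟨q, Finset.mem_compl.2 hq⟩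
  have hk := Submodule.finrank_mono hker
  rw [Submodule.finrank_map_subtype_eq] at hk
  have hrange := Submodule.finrank_le (LinearMap.range f)
  have hdim : Module.finrank F2 ((Mᶜ : Finset Q) → F2 × F2) = 2 * #Mᶜ := by
    rw [Module.finrank_pi_fintype]
    simp [mul_comm]
  have := f.finrank_range_add_finrank_ker
  lia

end PauliDuality

section Lattice

variable {L : ℕ} {G : Submodule F2 (PauliSpace (Fin L × Fin L))}

/-- No square box of size `r × r` contains both sites. -/
def SitesSeparated (r : ℕ) (p q : Fin L × Fin L) : Prop :=
  (p.1 : ℕ) + r ≤ q.1 ∨ (q.1 : ℕ) + r ≤ p.1 ∨ (p.2 : ℕ) + r ≤ q.2 ∨ (q.2 : ℕ) + r ≤ p.2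

/-- A bare operator whose support splits into two separated parts restricts to a bare operator
on each part. -/
lemma projL_mem_pcent {r : ℕ} (hG : HasLocalGens r G) {v : PauliSpace (Fin L × Fin L)}
    (hv : v ∈ pcent G) {A : Finset (Fin L × Fin L)}
    (hA : ∀ p ∈ A, v p ≠ 0 → ∀ q ∉ A, v q ≠ 0 → SitesSeparated r p q) :
    projL A v ∈ pcent G := by
  obtain ⟨gens, rfl, hbox⟩ := hG
  rw [mem_pcent_span] at hv ⊢
  intro g hg
  by_cases hmeet : ∃ p ∈ A, v p ≠ 0 ∧ g p ≠ 0
  · obtain ⟨p, hpA, hvp, hgp⟩ := hmeet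
    rw [← hv g hg]
    refine Finset.sum_congr rfl fun q _ => ?_
    by_cases hqA : q ∈ A
    · simp [projL_apply, hqA]
    by_cases hvq : v q = 0
    · simp [projL_apply, hvq]
    by_cases hgq : g q = 0
    · simp [hgq]
    obtain ⟨a, b, hab⟩ := hbox g hg
    have hp := hab p (Finset.mem_filter.2 ⟨Finset.mem_univ _, hgp⟩)
    have hq := hab q (Finset.mem_filter.2 ⟨Finset.mem_univ _, hgq⟩)
    rcases hA p hpA hvp q hqA hvq with h | h | h | h <;> lia
  · push Not at hmeet
    refine omegaF_eq_zero_of_forall fun q => ?_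
    by_cases hqA : q ∈ A
    · by_cases hvq : v q = 0
      · simp [projL_apply, hvq]
      · exact Or.inr (hmeet q hqA hvq)
    · simp [projL_apply, hqA]

/-- Sites of the lattice in the square centred at `(a, b)` of half-side `s`. -/
def latticeBox (L : ℕ) (a b : ℤ) (s : ℕ) : Finset (Fin L × Fin L) :=
  {q | a - s ≤ (q.1 : ℕ) ∧ ((q.1 : ℕ) : ℤ) < a + s ∧ b - s ≤ (q.2 : ℕ) ∧ ((q.2 : ℕ) : ℤ) < b + s}

lemma mem_latticeBox {a b : ℤ} {s : ℕ} {q : Fin L × Fin L} :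
    q ∈ latticeBox L a b s ↔ a - s ≤ (q.1 : ℕ) ∧ ((q.1 : ℕ) : ℤ) < a + s ∧
      b - s ≤ (q.2 : ℕ) ∧ ((q.2 : ℕ) : ℤ) < b + s := by
  simp [latticeBox]

lemma card_latticeBox_sdiff_le (a b : ℤ) (s r : ℕ) :
    #(latticeBox L a b (s + r) \ latticeBox L a b s) ≤ 4 * r * (2 * s + r) := by
  let B : ℕ → Finset (ℤ × ℤ) := fun t => Finset.Ico (a - t) (a + t) ×ˢ Finset.Ico (b - t) (b + t)
  have hB : ∀ t, #(B t) = (2 * t) * (2 * t) := fun t => by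
    simp only [B, Finset.card_product, Int.card_Ico]
    congr 1 <;> lia
  have hsub : B s ⊆ B (s + r) := fun q hq => by
    simp only [B, Finset.mem_product, Finset.mem_Ico] at hq ⊢
    lia
  have hcard : #(B (s + r) \ B s) = 4 * r * (2 * s + r) := by
    rw [Finset.card_sdiff_of_subset hsub, hB, hB]
    exact Nat.sub_eq_of_eq_add (by ring)
  rw [← hcard]
  refine Finset.card_le_card_of_injOn (fun q => (((q.1 : ℕ) : ℤ), ((q.2 : ℕ) : ℤ))) ?_ ?_
  · intro q hq
    simp only [Finset.coe_sdiff, Set.mem_sdiff, Finset.mem_coe, mem_latticeBox] at hq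
    simp only [B, Finset.coe_sdiff, Set.mem_sdiff, Finset.mem_coe, Finset.mem_product,
      Finset.mem_Ico]
    lia
  · intro p _ q _ h
    simp only [Prod.mk.injEq, Nat.cast_inj] at h
    exact Prod.ext (Fin.ext h.1) (Fin.ext h.2)

/-- Triviality of the bare logical operators in a box extends to the box enlarged by `r`, as long
as the added frame has fewer sites than the distance. -/
lemma bare_trivial_latticeBox_add {r : ℕ} (hG : HasLocalGens r G) {a b : ℤ} {s : ℕ}
    (hs : pcent G ⊓ PMod (latticeBox L a b s) ≤ G)
    (hd : 4 * r * (2 * s + r) < sInf (distSet G)) :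
    pcent G ⊓ PMod (latticeBox L a b (s + r)) ≤ G := by
  rintro v ⟨hv, hvB⟩
  rw [← pcent_pcent G]
  intro w hw
  obtain ⟨t, ht, hwt⟩ := exists_add_mem_PMod_compl
    (le_gauge_of_card_lt ((card_latticeBox_sdiff_le a b s r).trans_lt hd)) hw
  set u := w + t with hu
  have huG : u ∈ pcent G := add_mem hw ht.2
  have houter : ∀ q ∉ latticeBox L a b s, u q ≠ 0 → q ∉ latticeBox L a b (s + r) :=
    fun q hq huq hq' => huq (hwt q (by simp [hq, hq']))
  have hin : projL (latticeBox L a b s) u ∈ G := by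
    refine hs ⟨projL_mem_pcent hG huG fun p hp _ q hq huq => ?_, projL_mem_PMod _ _⟩
    have hq' := houter q hq huq
    rw [mem_latticeBox] at hp hq'
    push_cast at hq'
    unfold SitesSeparated
    omega
  have hout : omegaF v (u - projL (latticeBox L a b s) u) = 0 := by
    refine omegaF_eq_zero_of_forall fun q => ?_
    by_cases hq : q ∈ latticeBox L a b s
    · simp [projL_apply, hq]
    by_cases huq : u q = 0
    · simp [projL_apply, huq]
    · exact Or.inl (hvB q (houter q hq huq))
  have hvu : omegaF v u = 0 := by
    rw [← add_sub_cancel (projL (latticeBox L a b s) u) u, omegaF_add_right, hout, hv _ hin,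
      add_zero]
  rwa [hu, omegaF_add_right, hv t ht.1, add_zero] at hvu

lemma bare_trivial_latticeBox {r : ℕ} (hG : HasLocalGens r G) (a b : ℤ) (J : ℕ)
    (hJ : 8 * r ^ 2 * J < sInf (distSet G)) :
    pcent G ⊓ PMod (latticeBox L a b (J * r)) ≤ G := by
  induction J with
  | zero =>
    rintro v ⟨-, hv⟩
    have : v = 0 := funext fun q => hv q (by rw [mem_latticeBox]; lia)
    exact this ▸ zero_mem G
  | succ J ih =>
    rw [add_mul, one_mul]
    exact bare_trivial_latticeBox_add hG (ih (lt_of_le_of_lt (by gcongr; simp) hJ))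
      (lt_of_le_of_lt (by nlinarith [sq_nonneg r]) hJ)

/-- The union of square tiles of side `m`, placed with period `m + r` in both directions. -/
def tiling (L m r : ℕ) : Finset (Fin L × Fin L) :=
  {q | (q.1 : ℕ) % (m + r) < m ∧ (q.2 : ℕ) % (m + r) < m}

lemma add_le_of_div_lt_div {m r x y : ℕ} (hx : x % (m + r) < m)
    (h : x / (m + r) < y / (m + r)) : x + r ≤ y := by
  have hxd := Nat.div_add_mod x (m + r)
  have hyd := Nat.div_mul_le_self y (m + r)
  have := Nat.mul_le_mul_right (m + r) (Nat.succ_le_of_lt h)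
  rw [Nat.succ_mul] at this
  rw [mul_comm] at hxd
  lia

lemma bare_trivial_tiling {r : ℕ} (hG : HasLocalGens r G) {J : ℕ}
    (hJ : 8 * r ^ 2 * J < sInf (distSet G)) :
    pcent G ⊓ PMod (tiling L (2 * (J * r)) r) ≤ G := by
  rintro v ⟨hv, hvU⟩
  set m := 2 * (J * r) with hm
  let tile : Fin L × Fin L → ℕ × ℕ := fun q => ((q.1 : ℕ) / (m + r), (q.2 : ℕ) / (m + r))
  have hU : ∀ q, v q ≠ 0 → (q.1 : ℕ) % (m + r) < m ∧ (q.2 : ℕ) % (m + r) < m := fun q hq => by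
    by_contra h
    exact hq (hvU q (by simpa [tiling] using h))
  have hsum : v = ∑ t ∈ Finset.univ.image tile, projL {q | tile q = t} v := by
    funext q
    simp [Finset.sum_apply, projL_apply]
  rw [hsum]
  refine Submodule.sum_mem _ fun t _ => bare_trivial_latticeBox hG
    (t.1 * (m + r) + J * r : ℕ) (t.2 * (m + r) + J * r : ℕ) J hJ
    ⟨projL_mem_pcent hG hv fun p hp hvp q hq hvq => ?_, fun q hq => ?_⟩
  · have hne : tile q ≠ tile p := by
      simp only [Finset.mem_filter, Finset.mem_univ, true_and] at hp hq
      rwa [hp]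
    have hpU := hU p hvp
    have hqU := hU q hvq
    by_cases h1 : (q.1 : ℕ) / (m + r) = (p.1 : ℕ) / (m + r)
    · have h2 : (q.2 : ℕ) / (m + r) ≠ (p.2 : ℕ) / (m + r) := fun h2 => hne (Prod.ext h1 h2)
      rcases lt_or_gt_of_ne h2 with h | h
      · exact Or.inr (Or.inr (Or.inr (add_le_of_div_lt_div hqU.2 h)))
      · exact Or.inr (Or.inr (Or.inl (add_le_of_div_lt_div hpU.2 h)))
    · rcases lt_or_gt_of_ne h1 with h | h
      · exact Or.inr (Or.inl (add_le_of_div_lt_div hqU.1 h))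
      · exact Or.inl (add_le_of_div_lt_div hpU.1 h)
  · rw [projL_apply]
    split_ifs with ht
    · by_contra hvq
      have hqU := hU q hvq
      obtain rfl : tile q = t := by simpa using ht
      refine hq (mem_latticeBox.2 ?_)
      have hcoord : ∀ x c y s : ℕ, c + y = x → y < 2 * s →
          ((c + s : ℕ) : ℤ) - s ≤ x ∧ (x : ℤ) < (c + s : ℕ) + s := by lia
      exact and_assoc.1 ⟨hcoord _ _ _ _ (Nat.div_add_mod' _ _) hqU.1,
        hcoord _ _ _ _ (Nat.div_add_mod' _ _) hqU.2⟩
    · rfl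

lemma mul_count_mod_le (m r L : ℕ) :
    (m + r) * Nat.count (fun x => m ≤ x % (m + r)) L ≤ r * L := by
  have hsmall : ∀ t ≤ r, Nat.count (fun x => m ≤ x % (m + r)) (m + t) ≤ t := fun t ht => by
    rw [Nat.count_add, Nat.count_iff_forall_not.2, zero_add]
    · exact Nat.count_le _
    · intro x hx
      have := Nat.mod_le x (m + r)
      lia
  induction L using Nat.strong_induction_on with
  | _ L ih =>
    rcases Nat.eq_zero_or_pos (m + r) with h0 | hpos
    · simp [h0]
    rcases le_or_gt (m + r) L with hL | hL
    · obtain ⟨L, rfl⟩ := Nat.exists_eq_add_of_le hL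
      have hih := ih L (by lia)
      have hr := hsmall r le_rfl
      rw [Nat.count_add]
      simp only [Nat.add_mod_left]
      nlinarith
    · rcases le_or_gt m L with hm | hm
      · obtain ⟨t, rfl⟩ := Nat.exists_eq_add_of_le hm
        have := hsmall t (by lia)
        nlinarith
      · rw [Nat.count_iff_forall_not.2]
        · simp
        · intro x hx
          have := Nat.mod_le x (m + r)
          lia

lemma mul_card_compl_tiling_le (L m r : ℕ) : (m + r) * #(tiling L m r)ᶜ ≤ 2 * r * L ^ 2 := by
  let X : Finset (Fin L) := {x | m ≤ (x : ℕ) % (m + r)}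
  have hX : #X = Nat.count (fun x => m ≤ x % (m + r)) L := by
    rw [Nat.count_eq_card_filter_range, ← Finset.card_map Fin.valEmbedding]
    congr 1
    ext x
    simp only [X, Finset.mem_map, Finset.mem_filter, Finset.mem_univ, true_and, Finset.mem_range,
      Fin.valEmbedding_apply]
    exact ⟨by rintro ⟨y, hy, rfl⟩; exact ⟨y.2, hy⟩, fun h => ⟨⟨x, h.1⟩, h.2, rfl⟩⟩
  have hsub : (tiling L m r)ᶜ ⊆ X ×ˢ Finset.univ ∪ Finset.univ ×ˢ X := fun q hq => by
    simp only [tiling, Finset.mem_compl, Finset.mem_filter, Finset.mem_univ, true_and, X,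
      Finset.mem_union, Finset.mem_product, and_true] at hq ⊢
    lia
  have hcard : #(tiling L m r)ᶜ ≤ 2 * L * #X := by
    refine (Finset.card_le_card hsub).trans ((Finset.card_union_le _ _).trans (le_of_eq ?_))
    simp only [Finset.card_product, Finset.card_univ, Fintype.card_fin]
    ring
  have hcount := mul_count_mod_le m r L
  rw [← hX] at hcount
  calc (m + r) * #(tiling L m r)ᶜ ≤ (m + r) * (2 * L * #X) := by gcongr
    _ = 2 * L * ((m + r) * #X) := by ring
    _ ≤ 2 * L * (r * L) := by gcongr
    _ = 2 * r * L ^ 2 := by ring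

end Lattice

/-- Upper bound `kd = O(n)` for 2D subsystem codes with spatially local gauge
generators, where `n = L²` is the number of physical qubits. -/
theorem kd_upper_bound (r : ℕ) (hr : 0 < r) :
    ∃ C : ℝ, 0 < C ∧ ∀ L : ℕ, ∀ G : Submodule F2 (PauliSpace (Fin L × Fin L)),
      HasLocalGens r G →
      ∀ k : ℕ, 1 ≤ k →
      Module.finrank F2 ↥(pcent G) = Module.finrank F2 ↥(pstab G) + 2 * k →
      ∀ d : ℕ, d = sInf (distSet G) →
      (k : ℝ) * d ≤ C * (L : ℝ) ^ 2 := by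
  refine ⟨16 * r ^ 2, by positivity, fun L G hG k _ hk d hd => ?_⟩
  rcases Nat.eq_zero_or_pos d with rfl | hdpos
  · simp only [Nat.cast_zero, mul_zero]
    positivity
  set J := (d - 1) / (8 * r ^ 2) with hJdef
  have hJ : 8 * r ^ 2 * J < sInf (distSet G) := by
    have := Nat.mul_div_le (d - 1) (8 * r ^ 2)
    lia
  have hdJ : d ≤ 8 * r * (2 * (J * r) + r) := by
    have := Nat.lt_mul_div_succ (d - 1) (b := 8 * r ^ 2) (by positivity)
    rw [← hJdef] at this
    have hle : d ≤ 8 * r ^ 2 * (J + 1) := by lia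
    nlinarith [Nat.zero_le (r ^ 2 * J)]
  have hkU := finrank_pcent_le (bare_trivial_tiling hG hJ)
  have hcard := mul_card_compl_tiling_le L (2 * (J * r)) r
  have hle : k * d ≤ 16 * r ^ 2 * L ^ 2 := by
    calc k * d ≤ #(tiling L (2 * (J * r)) r)ᶜ * (8 * r * (2 * (J * r) + r)) := by
          gcongr
          lia
      _ = 8 * r * ((2 * (J * r) + r) * #(tiling L (2 * (J * r)) r)ᶜ) := by ring
      _ ≤ 8 * r * (2 * r * L ^ 2) := by gcongr
      _ = 16 * r ^ 2 * L ^ 2 := by ring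
  exact_mod_cast hle
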